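/- Let E be a finite-dimensional real inner product space and let A ⊆ E be a nonempty, closed, convex subset containing no affine line, with asymptotic cone λ_A = {v ∈ E : a + t • v ∈ A for all a ∈ A and all t ≥ 0} and polar λ_A° = {y ∈ E : ⟪v, y⟫ ≥ 0 for all v ∈ λ_A}. Then the topological interior in E × ℝ of the closed convex set C = {(y, t) ∈ E × ℝ : ⟪x, y⟫ ≥ t for all x ∈ A} equals {(y, t) ∈ E × ℝ : y belongs to the interior of λ_A° and t < sInf {⟪x, y⟫ : x ∈ A}}. -/

import Mathlib

open RealInnerProductSpace

/-- If normalized points of a closed convex set `A`, of norms tending to infinity, converge to `v`,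
then `v` is a recession direction of `A`. -/
theorem Convex.add_smul_mem_of_tendsto_normalized
    {E : Type*} [NormedAddCommGroup E] [NormedSpace ℝ E] {A : Set E}
    (hA : IsClosed A) (hconv : Convex ℝ A) {x : ℕ → E} {v : E} (hx : ∀ n, x n ∈ A)
    (hnorm : Filter.Tendsto (fun n => ‖x n‖) Filter.atTop Filter.atTop)
    (hv : Filter.Tendsto (fun n => ‖x n‖⁻¹ • x n) Filter.atTop (nhds v))
    {a : E} (ha : a ∈ A) {t : ℝ} (ht : 0 ≤ t) : a + t • v ∈ A := by
  have hinv : Filter.Tendsto (fun n => t * ‖x n‖⁻¹) Filter.atTop (nhds 0) := by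
    simpa using hnorm.inv_tendsto_atTop.const_mul t
  have hlim : Filter.Tendsto
      (fun n => (1 - t * ‖x n‖⁻¹) • a + (t * ‖x n‖⁻¹) • x n) Filter.atTop
      (nhds (a + t • v)) := by
    have h := ((hinv.const_sub 1).smul_const a).add (hv.const_smul t)
    simpa [mul_smul] using h
  refine hA.mem_of_tendsto hlim ?_
  filter_upwards [hinv.eventually (gt_mem_nhds one_pos)] with n hn
  exact hconv ha (hx n) (by linarith) (by positivity) (by ring)

/-- A linear functional positive on the nonzero recession directions of a closed convex set grows
at least linearly on that set. -/
theorem Convex.exists_mul_norm_le_inner_of_pos_on_recession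
    {E : Type*} [NormedAddCommGroup E] [InnerProductSpace ℝ E] [FiniteDimensional ℝ E]
    {A : Set E} (hA : IsClosed A) (hconv : Convex ℝ A) {y : E}
    (hy : ∀ v : E, v ≠ 0 → (∀ a ∈ A, ∀ t : ℝ, 0 ≤ t → a + t • v ∈ A) → 0 < ⟪v, y⟫) :
    ∃ δ > 0, ∃ R > 0, ∀ x ∈ A, R ≤ ‖x‖ → δ * ‖x‖ ≤ ⟪x, y⟫ := by
  by_contra! hcon
  have hpos (n : ℕ) : (0 : ℝ) < (n : ℝ) + 1 := by positivity
  choose x hxA hxn hxy using fun n : ℕ =>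
    hcon (1 / ((n : ℝ) + 1)) (one_div_pos.2 (hpos n)) ((n : ℝ) + 1) (hpos n)
  have hx0 (n : ℕ) : 0 < ‖x n‖ := (hpos n).trans_le (hxn n)
  have hsphere (n : ℕ) : ‖x n‖⁻¹ • x n ∈ Metric.sphere (0 : E) 1 := by
    simp [norm_smul, (hx0 n).ne']
  obtain ⟨v, hvs, φ, hφ, hlim⟩ := (isCompact_sphere (0 : E) 1).tendsto_subseq hsphere
  have hnorm : Filter.Tendsto (fun n => ‖x n‖) Filter.atTop Filter.atTop :=
    Filter.tendsto_atTop_mono (fun n => (by linarith [hxn n] : (n : ℝ) ≤ ‖x n‖))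
      tendsto_natCast_atTop_atTop
  have hv0 : v ≠ 0 := by
    rintro rfl
    simp at hvs
  have hvpos : 0 < ⟪v, y⟫ := hy v hv0 fun a ha t ht =>
    hconv.add_smul_mem_of_tendsto_normalized hA (x := x ∘ φ) (fun n => hxA (φ n))
      (hnorm.comp hφ.tendsto_atTop) hlim ha ht
  have hle : ⟪v, y⟫ ≤ 0 := by
    refine le_of_tendsto_of_tendsto' (hlim.inner tendsto_const_nhds)
      ((tendsto_one_div_add_atTop_nhds_zero_nat (𝕜 := ℝ)).comp hφ.tendsto_atTop) fun n => ?_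
    have h := hxy (φ n)
    simp only [Function.comp_apply, real_inner_smul_left]
    rw [inv_mul_le_iff₀ (hx0 _), mul_comm]
    exact h.le
  exact hvpos.not_ge hle

/-- An interior point of a polar cone pairs positively with every nonzero element of the cone. -/
theorem inner_pos_of_mem_interior_polar
    {E : Type*} [NormedAddCommGroup E] [InnerProductSpace ℝ E] {K : Set E} {y v : E}
    (hy : y ∈ interior {y : E | ∀ v ∈ K, 0 ≤ ⟪v, y⟫}) (hv : v ∈ K) (hv0 : v ≠ 0) :
    0 < ⟪v, y⟫ := by
  have hlim : Filter.Tendsto (fun s : ℝ => y - s • v) (nhdsWithin 0 (Set.Ioi 0)) (nhds y) := by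
    have h : Continuous fun s : ℝ => y - s • v := by fun_prop
    simpa using (h.tendsto 0).mono_left nhdsWithin_le_nhds
  obtain ⟨s, hs, hs0⟩ :=
    ((hlim.eventually (mem_interior_iff_mem_nhds.1 hy)).and self_mem_nhdsWithin).exists
  have h := hs v hv
  rw [inner_sub_right, real_inner_smul_right, real_inner_self_eq_norm_sq] at h
  have hs0 : 0 < s := hs0
  have : 0 < s * ‖v‖ ^ 2 := by positivity
  linarith

/-- A functional bounded below on a nonempty set is nonnegative on its recession directions. -/
theorem inner_nonneg_of_recession
    {E : Type*} [NormedAddCommGroup E] [InnerProductSpace ℝ E] {A : Set E} (hne : A.Nonempty)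
    {y v : E} {c : ℝ} (hc : ∀ x ∈ A, c ≤ ⟪x, y⟫)
    (hv : ∀ a ∈ A, ∀ t : ℝ, 0 ≤ t → a + t • v ∈ A) : 0 ≤ ⟪v, y⟫ := by
  obtain ⟨a, ha⟩ := hne
  by_contra! hneg
  have hca := hc a ha
  have h := hc _ (hv a ha ((⟪a, y⟫ - c + 1) / -⟪v, y⟫)
    (div_nonneg (by linarith) (by linarith)))
  rw [inner_add_left, real_inner_smul_left, div_neg, neg_mul, div_mul_cancel₀ _ hneg.ne] at h
  linarith

/-- Let `A` be a nonempty closed convex subset, containing no affine line, of a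
finite-dimensional real inner product space `E`, with asymptotic cone `λ_A` and polar
`λ_A°`. Then the interior in `E × ℝ` of `C = {(y, t) : ⟪x, y⟫ ≥ t for all x ∈ A}`
equals `{(y, t) : y ∈ interior λ_A° and t < inf_{x ∈ A} ⟪x, y⟫}`. -/
theorem interior_polar_conification_eq
    {E : Type*} [NormedAddCommGroup E] [InnerProductSpace ℝ E] [FiniteDimensional ℝ E]
    (A : Set E) (hne : A.Nonempty) (hA : IsClosed A) (hconv : Convex ℝ A)
    (hline : ¬ ∃ (a v : E), v ≠ 0 ∧ ∀ t : ℝ, a + t • v ∈ A) :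
    interior {q : E × ℝ | ∀ x ∈ A, q.2 ≤ ⟪x, q.1⟫} =
      {q : E × ℝ |
        q.1 ∈ interior {y : E |
          ∀ v ∈ {v : E | ∀ a ∈ A, ∀ t : ℝ, 0 ≤ t → a + t • v ∈ A}, 0 ≤ ⟪v, y⟫} ∧
        q.2 < sInf {z : ℝ | ∃ x ∈ A, z = ⟪x, q.1⟫}} := by
  apply Set.Subset.antisymm
  · rintro ⟨y, t⟩ hq
    refine ⟨?_, ?_⟩
    · refine interior_maximal ?_ (isOpenMap_fst _ isOpen_interior) ⟨_, hq, rfl⟩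
      rintro _ ⟨⟨z, s⟩, hz, rfl⟩ v hv
      exact inner_nonneg_of_recession hne (interior_subset hz) hv
    · have hlim : Filter.Tendsto (fun s : ℝ => (y, s)) (nhdsWithin t (Set.Ioi t))
          (nhds (y, t)) :=
        ((by fun_prop : Continuous fun s : ℝ => (y, s)).tendsto t).mono_left nhdsWithin_le_nhds
      obtain ⟨s, hs, hts⟩ :=
        ((hlim.eventually (mem_interior_iff_mem_nhds.1 hq)).and self_mem_nhdsWithin).exists
      obtain ⟨a, ha⟩ := hne
      refine lt_of_lt_of_le hts (le_csInf ⟨_, a, ha, rfl⟩ ?_)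
      rintro _ ⟨x, hx, rfl⟩
      exact hs x hx
  · rintro ⟨y, t⟩ ⟨hy, ht⟩
    obtain ⟨δ, hδ, R, hR, hgrow⟩ :=
      hconv.exists_mul_norm_le_inner_of_pos_on_recession hA (y := y)
        fun v hv0 hv => inner_pos_of_mem_interior_polar hy hv hv0
    have hbdd : BddBelow {z : ℝ | ∃ x ∈ A, z = ⟪x, y⟫} := by
      refine ⟨-(R * ‖y‖), ?_⟩
      rintro _ ⟨x, hx, rfl⟩
      rcases le_total R ‖x‖ with h | h
      · have h1 := hgrow x hx h
        have h2 : 0 ≤ δ * ‖x‖ := by positivity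
        have h3 : 0 ≤ R * ‖y‖ := by positivity
        linarith
      · have h1 := neg_le_of_abs_le (abs_real_inner_le_norm x y)
        have h2 := mul_le_mul_of_nonneg_right h (norm_nonneg y)
        linarith
    set m := sInf {z : ℝ | ∃ x ∈ A, z = ⟪x, y⟫}
    have hm : ∀ x ∈ A, m ≤ ⟪x, y⟫ := fun x hx => csInf_le hbdd ⟨x, hx, rfl⟩
    change t < m at ht
    set S := max R (2 * (|t| + 1) / δ)
    have hdist : Filter.Tendsto (fun q : E × ℝ => ‖q.1 - y‖) (nhds (y, t)) (nhds 0) := by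
      have h : Continuous fun q : E × ℝ => ‖q.1 - y‖ := by fun_prop
      simpa using h.tendsto (y, t)
    have hsnd : Filter.Tendsto (fun q : E × ℝ => q.2 + S * ‖q.1 - y‖) (nhds (y, t))
        (nhds t) := by
      simpa using (continuous_snd.tendsto (y, t)).add (hdist.const_mul S)
    have ht' : t < |t| + 1 := by linarith [le_abs_self t]
    rw [mem_interior_iff_mem_nhds]
    filter_upwards [hdist.eventually (gt_mem_nhds (half_pos hδ)),
      hsnd.eventually (gt_mem_nhds ht),
      (continuous_snd.tendsto (y, t)).eventually (gt_mem_nhds ht')] with q hq1 hq2 hq3 x hx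
    have hsplit : ⟪x, q.1⟫ = ⟪x, y⟫ + ⟪x, q.1 - y⟫ := by
      rw [inner_sub_right]
      ring
    have hinner := neg_le_of_abs_le (abs_real_inner_le_norm x (q.1 - y))
    rw [hsplit]
    rcases le_total S ‖x‖ with h | h
    · have h1 := hgrow x hx ((le_max_left _ _).trans h)
      have h2 := mul_le_mul_of_nonneg_left hq1.le (norm_nonneg x)
      have h3 := (div_le_iff₀ hδ).1 ((le_max_right _ _).trans h)
      linarith
    · have h1 := mul_le_mul_of_nonneg_right h (norm_nonneg (q.1 - y))
      have h2 := hm x hx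
      linarith
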